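/- Let Ā be a smooth Yang–Mills potential on ℝⁿ solving the Yang–Mills equations D̄_μ F̄^{μν} = 0, and let f̃ : ℝⁿ → M_N(ℝ) satisfy D̄_μ f̃ = 0 for all μ. Let a : ℝⁿ → (M_N(ℝ))ⁿ be a smooth solution of the linearized Yang–Mills equations around Ā: D̄_μ(D̄^μ a^ν − D̄^ν a^μ) + [a_μ, F̄^{μν}] = 0 for all ν. Then the linear conserved form k^{μν} = Tr(f̃ (D̄^μ a^ν − D̄^ν a^μ)) satisfies Σ_μ ∂_μ k^{μν} = 0 identically on ℝⁿ, for every ν. -/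

import Mathlib

noncomputable section

/-- Partial derivative of a real-valued function on ℝⁿ in the μ-th coordinate direction. -/
def pdR {n : ℕ} (μ : Fin n) (f : (Fin n → ℝ) → ℝ) : (Fin n → ℝ) → ℝ :=
  fun x => fderiv ℝ f x (Pi.single μ 1)

/-- Entrywise partial derivative of a matrix-valued function on ℝⁿ. -/
def pdM {n N : ℕ} (μ : Fin n) (X : (Fin n → ℝ) → Matrix (Fin N) (Fin N) ℝ) :
    (Fin n → ℝ) → Matrix (Fin N) (Fin N) ℝ :=
  fun x => Matrix.of fun i j => pdR μ (fun y => X y i j) x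

/-- Matrix commutator [X, Y] = XY - YX. -/
def mcomm {N : ℕ} (X Y : Matrix (Fin N) (Fin N) ℝ) : Matrix (Fin N) (Fin N) ℝ :=
  X * Y - Y * X

/-- Covariant derivative D_μ X = ∂_μ X + [A_μ, X]. -/
def covD {n N : ℕ} (A : Fin n → (Fin n → ℝ) → Matrix (Fin N) (Fin N) ℝ)
    (μ : Fin n) (X : (Fin n → ℝ) → Matrix (Fin N) (Fin N) ℝ) :
    (Fin n → ℝ) → Matrix (Fin N) (Fin N) ℝ :=
  fun x => pdM μ X x + mcomm (A μ x) (X x)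

/-- Field strength F_{μν} = ∂_μ A_ν − ∂_ν A_μ + [A_μ, A_ν]. -/
def fieldStr {n N : ℕ} (A : Fin n → (Fin n → ℝ) → Matrix (Fin N) (Fin N) ℝ)
    (μ ν : Fin n) : (Fin n → ℝ) → Matrix (Fin N) (Fin N) ℝ :=
  fun x => pdM μ (A ν) x - pdM ν (A μ) x + mcomm (A μ x) (A ν x)

/-- Field strength with raised indices F^{μν} = η^{μα} η^{νβ} F_{αβ}. -/
def fieldStrUp {n N : ℕ} (ηinv : Fin n → Fin n → ℝ)
    (A : Fin n → (Fin n → ℝ) → Matrix (Fin N) (Fin N) ℝ)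
    (μ ν : Fin n) : (Fin n → ℝ) → Matrix (Fin N) (Fin N) ℝ :=
  fun x => ∑ α, ∑ β, (ηinv μ α * ηinv ν β) • fieldStr A α β x

/-- Raised-index covariant derivative of a covector field:
`D^μ a^ν = η^{μα} η^{νβ} (∂_α a_β + [A_α, a_β])`. -/
def covDUp {n N : ℕ} (ηinv : Fin n → Fin n → ℝ)
    (A : Fin n → (Fin n → ℝ) → Matrix (Fin N) (Fin N) ℝ)
    (μ ν : Fin n) (a : Fin n → (Fin n → ℝ) → Matrix (Fin N) (Fin N) ℝ) :
    (Fin n → ℝ) → Matrix (Fin N) (Fin N) ℝ :=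
  fun x => ∑ α, ∑ β, (ηinv μ α * ηinv ν β) • (pdM α (a β) x + mcomm (A α x) (a β x))

/-- Smoothness of a matrix-valued function, entrywise. -/
def SmoothM {n N : ℕ} (X : (Fin n → ℝ) → Matrix (Fin N) (Fin N) ℝ) : Prop :=
  ∀ i j, ContDiff ℝ (⊤ : ℕ∞) fun x => X x i j

namespace SmoothM

variable {n N : ℕ} {X Y : (Fin n → ℝ) → Matrix (Fin N) (Fin N) ℝ}

theorem differentiableAt (hX : SmoothM X) (i j : Fin N) (x : Fin n → ℝ) :
    DifferentiableAt ℝ (fun y => X y i j) x :=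
  (hX i j).differentiable (by simp) x

theorem add (hX : SmoothM X) (hY : SmoothM Y) : SmoothM fun y => X y + Y y :=
  fun i j => (hX i j).add (hY i j)

theorem sub (hX : SmoothM X) (hY : SmoothM Y) : SmoothM fun y => X y - Y y :=
  fun i j => (hX i j).sub (hY i j)

theorem const_smul (c : ℝ) (hX : SmoothM X) : SmoothM fun y => c • X y :=
  fun i j => contDiff_const.mul (hX i j)

theorem mul (hX : SmoothM X) (hY : SmoothM Y) : SmoothM fun y => X y * Y y := by
  intro i j
  simp only [Matrix.mul_apply]
  exact ContDiff.sum fun k _ => (hX i k).mul (hY k j)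

theorem mcomm (hX : SmoothM X) (hY : SmoothM Y) : SmoothM fun y => mcomm (X y) (Y y) :=
  (hX.mul hY).sub (hY.mul hX)

theorem sum {ι : Type*} (s : Finset ι) {Z : ι → (Fin n → ℝ) → Matrix (Fin N) (Fin N) ℝ}
    (hZ : ∀ k, SmoothM (Z k)) : SmoothM fun y => ∑ k ∈ s, Z k y := by
  intro i j
  simp only [Matrix.sum_apply]
  exact ContDiff.sum fun k _ => hZ k i j

theorem pdM (hX : SmoothM X) (μ : Fin n) : SmoothM (pdM μ X) := by
  intro i j
  exact ((hX i j).fderiv_right (m := (⊤ : ℕ∞)) (by simp)).clm_apply contDiff_const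

theorem covDUp (ηinv : Fin n → Fin n → ℝ)
    {A a : Fin n → (Fin n → ℝ) → Matrix (Fin N) (Fin N) ℝ}
    (hA : ∀ μ, SmoothM (A μ)) (ha : ∀ μ, SmoothM (a μ)) (μ ν : Fin n) :
    SmoothM (covDUp ηinv A μ ν a) :=
  sum _ fun α => sum _ fun β => (((ha β).pdM α).add ((hA α).mcomm (ha β))).const_smul _

end SmoothM

theorem pdM_sub {n N : ℕ} {X Y : (Fin n → ℝ) → Matrix (Fin N) (Fin N) ℝ}
    (hX : SmoothM X) (hY : SmoothM Y) (μ : Fin n) (x : Fin n → ℝ) :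
    pdM μ (fun y => X y - Y y) x = pdM μ X x - pdM μ Y x := by
  ext i j
  simp only [pdM, pdR, Matrix.of_apply, Matrix.sub_apply]
  rw [fderiv_fun_sub (hX.differentiableAt i j x) (hY.differentiableAt i j x)]
  rfl

theorem pdM_mul {n N : ℕ} {X Y : (Fin n → ℝ) → Matrix (Fin N) (Fin N) ℝ}
    (hX : SmoothM X) (hY : SmoothM Y) (μ : Fin n) (x : Fin n → ℝ) :
    pdM μ (fun y => X y * Y y) x = pdM μ X x * Y x + X x * pdM μ Y x := by
  ext i j
  simp only [pdM, pdR, Matrix.of_apply, Matrix.mul_apply, Matrix.add_apply]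
  rw [fderiv_fun_sum fun k _ => (hX.differentiableAt i k x).fun_mul (hY.differentiableAt k j x),
    sum_apply, ← Finset.sum_add_distrib]
  refine Finset.sum_congr rfl fun k _ => ?_
  rw [fderiv_fun_mul (hX.differentiableAt i k x) (hY.differentiableAt k j x)]
  simp only [add_apply, smul_apply, smul_eq_mul]
  ring

theorem pdM_mcomm {n N : ℕ} {X Y : (Fin n → ℝ) → Matrix (Fin N) (Fin N) ℝ}
    (hX : SmoothM X) (hY : SmoothM Y) (μ : Fin n) (x : Fin n → ℝ) :
    pdM μ (fun y => mcomm (X y) (Y y)) x = mcomm (pdM μ X x) (Y x) + mcomm (X x) (pdM μ Y x) := by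
  simp only [mcomm]
  rw [pdM_sub (hX.mul hY) (hY.mul hX), pdM_mul hX hY, pdM_mul hY hX]
  abel

theorem pdM_comm {n N : ℕ} {X : (Fin n → ℝ) → Matrix (Fin N) (Fin N) ℝ}
    (hX : SmoothM X) (μ ν : Fin n) (x : Fin n → ℝ) :
    pdM μ (pdM ν X) x = pdM ν (pdM μ X) x := by
  ext i j
  have hd : DifferentiableAt ℝ (fderiv ℝ fun y => X y i j) x :=
    ((hX i j).fderiv_right (m := (⊤ : ℕ∞)) (by simp)).differentiable (by simp) x
  have hsymm : IsSymmSndFDerivAt ℝ (fun y => X y i j) x :=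
    (hX i j).contDiffAt.isSymmSndFDerivAt
      (by simpa using WithTop.coe_le_coe.2 (le_top : (2 : ℕ∞) ≤ ⊤))
  simp only [pdM, pdR, Matrix.of_apply]
  rw [fderiv_clm_apply hd (differentiableAt_const _),
    fderiv_clm_apply hd (differentiableAt_const _)]
  simpa using hsymm (Pi.single μ 1) (Pi.single ν 1)

theorem pdR_trace {n N : ℕ} {X : (Fin n → ℝ) → Matrix (Fin N) (Fin N) ℝ}
    (hX : SmoothM X) (μ : Fin n) (x : Fin n → ℝ) :
    pdR μ (fun y => (X y).trace) x = (pdM μ X x).trace := by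
  simp only [pdM, pdR, Matrix.trace, Matrix.diag_apply, Matrix.of_apply]
  rw [fderiv_fun_sum fun k _ => hX.differentiableAt k k x, sum_apply]

/-- The trace turns the covariant Leibniz rule into an ordinary one. -/
theorem pdR_trace_mul {n N : ℕ} {A : Fin n → (Fin n → ℝ) → Matrix (Fin N) (Fin N) ℝ}
    {X Y : (Fin n → ℝ) → Matrix (Fin N) (Fin N) ℝ}
    (hX : SmoothM X) (hY : SmoothM Y) (μ : Fin n) (x : Fin n → ℝ) :
    pdR μ (fun y => (X y * Y y).trace) x =
      (covD A μ X x * Y x).trace + (X x * covD A μ Y x).trace := by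
  rw [pdR_trace (hX.mul hY), pdM_mul hX hY]
  simp only [covD, mcomm, add_mul, mul_add, sub_mul, mul_sub, Matrix.trace_add, Matrix.trace_sub]
  rw [Matrix.mul_assoc (A μ x) (X x) (Y x), Matrix.trace_mul_comm (A μ x),
    Matrix.mul_assoc (X x) (A μ x), Matrix.mul_assoc (X x) (Y x)]
  ring

/-- The field strength commutes with every covariantly constant matrix field. -/
theorem mcomm_fieldStr_eq_zero {n N : ℕ} {A : Fin n → (Fin n → ℝ) → Matrix (Fin N) (Fin N) ℝ}
    (hA : ∀ μ, SmoothM (A μ)) {f : (Fin n → ℝ) → Matrix (Fin N) (Fin N) ℝ} (hf : SmoothM f)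
    (hcov : ∀ μ x, covD A μ f x = 0) (μ ν : Fin n) (x : Fin n → ℝ) :
    mcomm (fieldStr A μ ν x) (f x) = 0 := by
  have hpd : ∀ ρ y, pdM ρ f y = mcomm (f y) (A ρ y) := by
    intro ρ y
    rw [eq_neg_of_add_eq_zero_left (hcov ρ y)]
    simp only [mcomm]
    abel
  have key := pdM_comm hf μ ν x
  rw [show pdM ν f = _ from funext (hpd ν), show pdM μ f = _ from funext (hpd μ),
    pdM_mcomm hf (hA ν), pdM_mcomm hf (hA μ), hpd μ, hpd ν] at key
  rw [← sub_eq_zero, ← neg_eq_zero] at key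
  rw [← key]
  simp only [fieldStr, mcomm]
  noncomm_ring

theorem mcomm_fieldStrUp_eq_zero {n N : ℕ} (ηinv : Fin n → Fin n → ℝ)
    {A : Fin n → (Fin n → ℝ) → Matrix (Fin N) (Fin N) ℝ}
    (hA : ∀ μ, SmoothM (A μ)) {f : (Fin n → ℝ) → Matrix (Fin N) (Fin N) ℝ} (hf : SmoothM f)
    (hcov : ∀ μ x, covD A μ f x = 0) (μ ν : Fin n) (x : Fin n → ℝ) :
    mcomm (fieldStrUp ηinv A μ ν x) (f x) = 0 := by
  have h : ∀ α β, fieldStr A α β x * f x = f x * fieldStr A α β x := fun α β =>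
    sub_eq_zero.mp (mcomm_fieldStr_eq_zero hA hf hcov α β x)
  simp only [mcomm, fieldStrUp, Finset.sum_mul, Finset.mul_sum, smul_mul_assoc, mul_smul_comm, h,
    sub_self]

theorem trace_mul_mcomm_eq_zero {N : ℕ} {X Y Z : Matrix (Fin N) (Fin N) ℝ}
    (h : mcomm Z X = 0) : (X * mcomm Y Z).trace = 0 := by
  have h' : Z * X = X * Z := sub_eq_zero.mp h
  rw [mcomm, mul_sub, Matrix.trace_sub, ← Matrix.mul_assoc, ← Matrix.mul_assoc,
    Matrix.trace_mul_comm (X * Y), ← Matrix.mul_assoc, h', sub_self]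

/-- For a background solution `Abar` of the Yang–Mills equations, a covariantly
constant `f`, and a solution `a` of the linearized Yang–Mills equations around `Abar`, the
linear form `k^{μν} = Tr(f (D̄^μ a^ν − D̄^ν a^μ))` satisfies `Σ_μ ∂_μ k^{μν} = 0` on ℝⁿ. -/
theorem linearized_yangMills_form_conserved
    {n N : ℕ} (hn : 1 ≤ n) (hN : 1 ≤ N)
    (η ηinv : Fin n → Fin n → ℝ)
    (hηsymm : ∀ μ ν, η μ ν = η ν μ)
    (hηinv : ∀ μ ν, ∑ ρ, η μ ρ * ηinv ρ ν = if μ = ν then 1 else 0)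
    (Abar : Fin n → (Fin n → ℝ) → Matrix (Fin N) (Fin N) ℝ)
    (hAbar : ∀ μ, SmoothM (Abar μ))
    (hYMbar : ∀ ν x, ∑ μ, covD Abar μ (fieldStrUp ηinv Abar μ ν) x = 0)
    (f : (Fin n → ℝ) → Matrix (Fin N) (Fin N) ℝ) (hf : SmoothM f)
    (hcov : ∀ μ x, pdM μ f x + mcomm (Abar μ x) (f x) = 0)
    (a : Fin n → (Fin n → ℝ) → Matrix (Fin N) (Fin N) ℝ)
    (ha : ∀ μ, SmoothM (a μ))
    (hlin : ∀ (ν : Fin n) (x : Fin n → ℝ),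
      ∑ μ, (covD Abar μ
            (fun y => covDUp ηinv Abar μ ν a y - covDUp ηinv Abar ν μ a y) x +
          mcomm (a μ x) (fieldStrUp ηinv Abar μ ν x)) = 0) :
    ∀ (ν : Fin n) (x : Fin n → ℝ),
      ∑ μ, pdR μ (fun y =>
        Matrix.trace (f y * (covDUp ηinv Abar μ ν a y - covDUp ηinv Abar ν μ a y))) x = 0 := by
  intro ν x
  have hcov' : ∀ μ x, covD Abar μ f x = 0 := hcov
  have hM : ∀ μ, SmoothM fun y => covDUp ηinv Abar μ ν a y - covDUp ηinv Abar ν μ a y :=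
    fun μ => (SmoothM.covDUp ηinv hAbar ha μ ν).sub (SmoothM.covDUp ηinv hAbar ha ν μ)
  have h := congrArg (fun M => (f x * M).trace) (hlin ν x)
  simp only [Finset.mul_sum, mul_add, Matrix.trace_sum, Matrix.trace_add, Matrix.mul_zero,
    Matrix.trace_zero, add_zero,
    trace_mul_mcomm_eq_zero (mcomm_fieldStrUp_eq_zero ηinv hAbar hf hcov' _ ν x)] at h
  rw [← h]
  refine Finset.sum_congr rfl fun μ _ => ?_
  rw [pdR_trace_mul (A := Abar) hf (hM μ), hcov', Matrix.zero_mul, Matrix.trace_zero, zero_add]
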